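/- arXiv:2308.12502 — 2 statements merged into one kernel-verified Lean document; each statement's English description precedes it below -/
import Mathlib

section
/- If a contract (d, r) satisfies Incentive Compatibility, then for all types j and m, (π_m − π_j)·(d_j − d_m) ≥ 0; in particular, if π_j < π_m then d_j ≥ d_m, i.e., any incentive-compatible contract assigns weakly smaller data sizes to types with larger aggregated marginal cost. -/
open Finset

/-- **Monotonicity of incentive-compatible contracts.**  With `J ≥ 1` user types indexed
`1,…,J`, aggregated marginal costs `π_1 ≤ … ≤ π_J`, revocation probabilities
`p_j ∈ [0,1)` and `κ_j = (1−p_j) π_j`, any contract `(d, r)` satisfying Incentive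
Compatibility obeys `(π_m − π_j)(d_j − d_m) ≥ 0` for all types `j, m`; in particular
`π_j < π_m` implies `d_m ≤ d_j`. -/
theorem IC_contract_monotone_data_sizes
    (J : ℕ) (hJ : 1 ≤ J) (pi p d r : ℕ → ℝ)
    (hmono : ∀ j ∈ Finset.Icc 1 J, ∀ m ∈ Finset.Icc 1 J, j ≤ m → pi j ≤ pi m)
    (hp : ∀ j ∈ Finset.Icc 1 J, 0 ≤ p j ∧ p j < 1)
    (hIC : ∀ j ∈ Finset.Icc 1 J, ∀ m ∈ Finset.Icc 1 J,
      (1 - p j) * r j - ((1 - p j) * pi j) * d j ≥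
        (1 - p j) * r m - ((1 - p j) * pi j) * d m) :
    ∀ j ∈ Finset.Icc 1 J, ∀ m ∈ Finset.Icc 1 J,
      (pi m - pi j) * (d j - d m) ≥ 0 ∧ (pi j < pi m → d m ≤ d j) := by
  have key : ∀ j ∈ Finset.Icc 1 J, ∀ m ∈ Finset.Icc 1 J,
      r m - pi j * d m ≤ r j - pi j * d j := by
    intro j hj m hm
    have h1 : 0 < 1 - p j := by linarith [(hp j hj).2]
    have h2 := hIC j hj m hm
    refine le_of_mul_le_mul_left ?_ h1
    linarith
  intro j hj m hm
  have h : (pi m - pi j) * (d j - d m) ≥ 0 := by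
    linarith [key j hj m hm, key m hm j hj]
  refine ⟨h, fun hlt => ?_⟩
  have h3 : 0 ≤ d j - d m := nonneg_of_mul_nonneg_right h (sub_pos.mpr hlt)
  linarith
end

section
/- All-independent case of Proposition 5: if A_1/B_1 ≥ A_2/B_2 ≥ … ≥ A_J/B_J, then the vector d* defined by d*_j = √(A_j/B_j) belongs to the feasible set D, and for every d ∈ D one has g(d) ≥ g(d*) = Σ_{j=1}^{J} 2·√(A_j·B_j); that is, d* minimizes the server's objective over D. -/
open Finset

/-- The feasible set of data-size vectors: `d_1 ≥ d_2 ≥ … ≥ d_J > 0`. -/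
def Dset (J : ℕ) : Set (Fin J → ℝ) :=
  {d | (∀ j m : Fin J, j ≤ m → d m ≤ d j) ∧ ∀ j, 0 < d j}

/-- The server's objective `g(d) = Σ_j (A_j / d_j + B_j d_j)`. -/
noncomputable def gObj {J : ℕ} (A B : Fin J → ℝ) (d : Fin J → ℝ) : ℝ :=
  ∑ j, (A j / d j + B j * d j)

/-- **All-independent case of Proposition 5.**  If `A_1/B_1 ≥ A_2/B_2 ≥ … ≥ A_J/B_J`
(with all `A_j, B_j > 0`), then `d*_j = √(A_j/B_j)` is feasible and minimizes the server's
objective over the feasible set, with optimal value `Σ_j 2 √(A_j B_j)`. -/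
theorem optimal_data_sizes_all_independent
    (J : ℕ) (hJ : 1 ≤ J) (A B : Fin J → ℝ)
    (hA : ∀ j, 0 < A j) (hB : ∀ j, 0 < B j)
    (hdesc : ∀ j m : Fin J, j ≤ m → A m / B m ≤ A j / B j) :
    (fun j => Real.sqrt (A j / B j)) ∈ Dset J ∧
    (∀ d ∈ Dset J, gObj A B (fun j => Real.sqrt (A j / B j)) ≤ gObj A B d) ∧
    gObj A B (fun j => Real.sqrt (A j / B j)) = ∑ j, 2 * Real.sqrt (A j * B j) := by
  have heq : gObj A B (fun j => Real.sqrt (A j / B j)) = ∑ j, 2 * Real.sqrt (A j * B j) := by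
    unfold gObj
    refine Finset.sum_congr rfl fun j _ => ?_
    have ha := Real.sqrt_pos.2 (hA j)
    have hb := Real.sqrt_pos.2 (hB j)
    have ha2 := Real.sq_sqrt (hA j).le
    have hb2 := Real.sq_sqrt (hB j).le
    simp only [Real.sqrt_div (hA j).le, Real.sqrt_mul (hA j).le]
    generalize Real.sqrt (A j) = a at *
    generalize Real.sqrt (B j) = b at *
    rw [← ha2, ← hb2]
    field_simp
    ring
  refine ⟨⟨fun j m h => Real.sqrt_le_sqrt (hdesc j m h),
    fun j => Real.sqrt_pos.2 (div_pos (hA j) (hB j))⟩, ?_, heq⟩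
  intro d hd
  rw [heq]
  unfold gObj
  refine Finset.sum_le_sum fun j _ => ?_
  have hdj := hd.2 j
  have ha2 := Real.sq_sqrt (hA j).le
  have hb2 := Real.sq_sqrt (hB j).le
  rw [Real.sqrt_mul (hA j).le]
  generalize Real.sqrt (A j) = a at *
  generalize Real.sqrt (B j) = b at *
  rw [← ha2, ← hb2]
  have h : a ^ 2 / d j + b ^ 2 * d j - 2 * (a * b) = (a - b * d j) ^ 2 / d j := by
    field_simp
    ring
  have h2 : 0 ≤ (a - b * d j) ^ 2 / d j := by positivity
  linarith
end
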